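/- Consider a single access by a minimally self-adjusting BST algorithm to element s, with search path P in tree T, producing tree T'. If s < a < b, a is a proper descendant of b on the search path P, and a and b have the same right-depth in the after-tree (i.e., {a,b} is monotone), then T'(a) ⊆ T(b): the subtree of a after the access is contained, as a set of elements, in the subtree of b before the access. -/

import Mathlib

namespace Paper

inductive BTree where
  | nil : BTree
  | node : BTree → ℕ → BTree → BTree
deriving DecidableEq

namespace BTree

def keys : BTree → Finset ℕ
  | nil => ∅
  | node l x r => insert x (keys l ∪ keys r)

def root? : BTree → Option ℕ
  | nil => none
  | node _ x _ => some x

def isBST : BTree → Prop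
  | nil => True
  | node l x r => (∀ y ∈ keys l, y < x) ∧ (∀ y ∈ keys r, x < y) ∧ isBST l ∧ isBST r

def subtree? (s : ℕ) : BTree → Option BTree
  | nil => none
  | node l x r => if s = x then some (node l x r) else if s < x then subtree? s l else subtree? s r

/-- The set of keys of the subtree rooted at `s` (∅ if `s` is not in the tree). -/
def subtreeKeys (T : BTree) (s : ℕ) : Finset ℕ := ((subtree? s T).map keys).getD ∅

/-- The search path to `s`, listed from the root downwards. -/
def pathList (s : ℕ) : BTree → List ℕ
  | nil => []
  | node l x r => if s = x then [x] else if s < x then x :: pathList s l else x :: pathList s r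

def pathSet (T : BTree) (s : ℕ) : Finset ℕ := (pathList s T).toFinset

def nodeDepth (s : ℕ) : BTree → ℕ
  | nil => 0
  | node l x r => if s = x then 0 else if s < x then nodeDepth s l + 1 else nodeDepth s r + 1

/-- Number of right-going edges on the path from the root to `s`. -/
def rightDepth (s : ℕ) : BTree → ℕ
  | nil => 0
  | node l x r => if s = x then 0 else if s < x then rightDepth s l else rightDepth s r + 1

/-- Number of left-going edges on the path from the root to `s`. -/
def leftDepth (s : ℕ) : BTree → ℕ
  | nil => 0
  | node l x r => if s = x then 0 else if s < x then leftDepth s l + 1 else leftDepth s r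

def leafCount : BTree → ℕ
  | nil => 0
  | node nil _ nil => 1
  | node l _ r => leafCount l + leafCount r

/-- The wing partition of a BST, each wing listed from its topmost node downwards. -/
def wings : BTree → List (List ℕ)
  | nil => []
  | node l x r =>
    match wings l with
    | [] => [x] :: wings r
    | wl :: rest => (x :: wl) :: (rest ++ wings r)

end BTree

open BTree

/-- The left-leaning path on `[n]`: `n` at the root, `1` at the deepest node. -/
def leftPathTree : ℕ → BTree
  | 0 => BTree.nil
  | n + 1 => BTree.node (leftPathTree n) (n + 1) BTree.nil

/-- Number of side alternations (w.r.t. `s`) between adjacent elements of a list. -/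
def sideAlt (s : ℕ) : List ℕ → ℕ
  | x :: y :: rest => (if (x < s ∧ s < y) ∨ (y < s ∧ s < x) then 1 else 0) + sideAlt s (y :: rest)
  | _ => 0

/-- The set of elements involved in side alternations (w.r.t. `s`) in a list. -/
def zigzagSet (s : ℕ) : List ℕ → Finset ℕ
  | x :: y :: rest =>
    (if (x < s ∧ s < y) ∨ (y < s ∧ s < x) then ({x, y} : Finset ℕ) else ∅) ∪ zigzagSet s (y :: rest)
  | _ => ∅

noncomputable def wsum (w : ℕ → ℝ) (X : Finset ℕ) : ℝ := ∑ b ∈ X, w b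

/-- Partial sum-of-logs potential of the set `X` in tree `T` (binary logarithm). -/
noncomputable def phiOn (w : ℕ → ℝ) (T : BTree) (X : Finset ℕ) : ℝ :=
  ∑ a ∈ X, Real.logb 2 (wsum w (subtreeKeys T a))

noncomputable def phiAll (w : ℕ → ℝ) (T : BTree) : ℝ := phiOn w T (keys T)

/-- A single access of a minimally self-adjusting BST algorithm: the accessed element `s`
becomes the root, the keys are unchanged, and every node off the search path keeps its
subtree; hence the search path is replaced by an after-tree rooted at `s` and the pendent
subtrees are reattached in the unique order-preserving way. -/
structure IsAccess (T : BTree) (s : ℕ) (T' : BTree) : Prop where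
  hT : isBST T
  hT' : isBST T'
  hs : s ∈ keys T
  hkeys : keys T' = keys T
  hroot : root? T' = some s
  hpendent : ∀ a ∈ keys T, a ∉ pathSet T s → subtree? a T' = subtree? a T

/-- The algorithm (viewed as the set of accesses it may perform) satisfies the access lemma
via the sum-of-logs potential. -/
def SatisfiesAL (Alg : BTree → ℕ → BTree → Prop) : Prop :=
  ∃ C : ℝ, 0 ≤ C ∧ ∀ T s T', Alg T s T' → ∀ w : ℕ → ℝ, (∀ i ∈ keys T, 0 < w i) →
    ((pathSet T s).card : ℝ) ≤
      phiAll w T - phiAll w T' + C * (1 + Real.logb 2 (wsum w (keys T) / w s))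

/-- `X` is subtree-disjoint (w.r.t. the tree after the access). -/
def SubtreeDisjoint (T' : BTree) (X : Finset ℕ) : Prop :=
  ∀ a ∈ X, ∀ b ∈ X, a ≠ b → subtreeKeys T' a ∩ subtreeKeys T' b = ∅

/-- `X` is monotone: all elements on one side of `s`, with equal right-depth
(resp. left-depth) in the after-tree.  (For nodes of the search path, depth in the
after-tree coincides with depth in `T'`.) -/
def IsMonotone (s : ℕ) (T' : BTree) (X : Finset ℕ) : Prop :=
  ((∀ x ∈ X, s < x) ∧ ∃ d, ∀ x ∈ X, rightDepth x T' = d) ∨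
  ((∀ x ∈ X, x < s) ∧ ∃ d, ∀ x ∈ X, leftDepth x T' = d)

/-- The after-tree minus its root can be partitioned into (at most) `k` monotone sets. -/
def MonotoneDecomp (T : BTree) (s : ℕ) (T' : BTree) (k : ℕ) : Prop :=
  ∃ M : Fin k → Finset ℕ,
    (∀ i, IsMonotone s T' (M i)) ∧
    (∀ i j, i ≠ j → Disjoint (M i) (M j)) ∧
    Finset.univ.biUnion M = pathSet T s \ {s}

/-- The leaves of the after-tree: path nodes having no path node as proper descendant in `T'`. -/
def afterLeaves (T : BTree) (s : ℕ) (T' : BTree) : Finset ℕ :=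
  (pathSet T s).filter (fun x => subtreeKeys T' x ∩ pathSet T s = {x})

/-- Rotate-to-root: `s` becomes the root and ancestor relations are otherwise preserved,
equivalently `T'(a) = T(a) ∩ (-∞,s)` for path nodes `a < s` and symmetrically for `a > s`. -/
def IsRotateToRoot (T : BTree) (s : ℕ) (T' : BTree) : Prop :=
  subtreeKeys T' s = keys T ∧
  ∀ a ∈ pathSet T s,
    (a < s → subtreeKeys T' a = (subtreeKeys T a).filter (fun b => b < s)) ∧
    (s < a → subtreeKeys T' a = (subtreeKeys T a).filter (fun b => s < b))

def pendTree : Option ℕ → BTree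
  | none => BTree.nil
  | some u => BTree.node BTree.nil u BTree.nil

def buildLeft (l : List (ℕ × Option ℕ)) : BTree :=
  l.foldl (fun t vc => BTree.node (pendTree vc.2) vc.1 t) BTree.nil

def buildRight (l : List (ℕ × Option ℕ)) : BTree :=
  l.foldl (fun t vc => BTree.node t vc.1 (pendTree vc.2)) BTree.nil

/-- Global view of splay: process the reversed search path `v₁, v₂, …` in pairs; if a pair
lies on the same side of `s`, the more ancestral element is removed from its path and
becomes a (pendant) child of the other.  Returns the two spines (elements `< s` and `> s`),
deepest first, each spine node with its optional pendant child. -/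
def splaySpines (s : ℕ) : List ℕ → List (ℕ × Option ℕ) × List (ℕ × Option ℕ)
  | [] => ([], [])
  | [v] => if v < s then ([(v, none)], []) else ([], [(v, none)])
  | v :: u :: rest =>
    let p := splaySpines s rest
    if v < s then
      if u < s then ((v, some u) :: p.1, p.2)
      else ((v, none) :: p.1, (u, none) :: p.2)
    else
      if u < s then ((u, none) :: p.1, (v, none) :: p.2)
      else (p.1, (v, some u) :: p.2)

/-- The after-tree of a splay access, built from the reversed search path without `s`. -/
def splayAfterTree (s : ℕ) (l : List ℕ) : BTree :=
  BTree.node (buildLeft (splaySpines s l).1) s (buildRight (splaySpines s l).2)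

/-- A splay access: a valid access whose after-tree (the restriction of `T'` to the search
path) is the splay after-tree. -/
def IsSplayAccess (T : BTree) (s : ℕ) (T' : BTree) : Prop :=
  IsAccess T s T' ∧
  ∀ x ∈ pathSet T s,
    subtreeKeys T' x ∩ pathSet T s = subtreeKeys (splayAfterTree s (pathList s T).reverse.tail) x

/-- A path-balance access: a valid access whose after-tree is a balanced BST of depth
`⌈log₂ (1 + |P|)⌉` rooted at `s`. -/
def IsPathBalanceAccess (T : BTree) (s : ℕ) (T' : BTree) : Prop :=
  IsAccess T s T' ∧
  ∀ x ∈ pathSet T s, nodeDepth x T' ≤ Nat.clog 2 (1 + (pathSet T s).card)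

def isParent (Q : BTree) (x y : ℕ) : Prop := pathList y Q = pathList x Q ++ [y]

/-- One step of a decomposition: a (descending) path `Pi` of `Q` is rearranged into a tree,
all other nodes keeping their subtrees. -/
def StepRel (Q Q' : BTree) (Pi : Finset ℕ) : Prop :=
  isBST Q' ∧ keys Q' = keys Q ∧
  (∃ l : List ℕ, l ≠ [] ∧ List.Chain' (isParent Q) l ∧ l.toFinset = Pi) ∧
  (∀ a ∈ keys Q, a ∉ Pi → subtree? a Q' = subtree? a Q)

/-- The transformation of the before-path `P0` (as a tree) into the after-tree `A` admits a
local decomposition with window size `wdw`. -/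
def HasLocalDecomp (s : ℕ) (P0 A : BTree) (wdw : ℕ) : Prop :=
  ∃ (k : ℕ) (Q : ℕ → BTree) (Ps : ℕ → Finset ℕ),
    1 ≤ k ∧ Q 0 = P0 ∧ Q k = A ∧
    (∀ i < k, StepRel (Q i) (Q (i + 1)) (Ps i)) ∧
    s ∈ Ps 0 ∧
    (∀ i, i + 1 < k → (Ps (i + 1) \ Ps i).Nonempty) ∧
    (∀ i, i + 1 < k → (Ps (i + 1) ∩ Ps i).Nonempty) ∧
    (∀ i j, i + 1 < j → j < k → Disjoint (Ps i \ Ps (i + 1)) (Ps j)) ∧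
    (∀ i < k, (Ps i).card ≤ wdw)

/-- The search path to `s` in `T`, as a tree (the before-path of the transformation). -/
def pathTree (s : ℕ) : BTree → BTree
  | BTree.nil => BTree.nil
  | BTree.node l x r =>
    if s = x then BTree.node BTree.nil x BTree.nil
    else if s < x then BTree.node (pathTree s l) x BTree.nil
    else BTree.node BTree.nil x (pathTree s r)

/-- `A` is the after-tree of the access `(T, s, T')`: the restriction of `T'` to the search path. -/
def IsAfterTree (T : BTree) (s : ℕ) (T' A : BTree) : Prop :=
  isBST A ∧ keys A = pathSet T s ∧
  ∀ x ∈ pathSet T s, subtreeKeys A x = subtreeKeys T' x ∩ pathSet T s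

/-- The algorithm is local with window size `wdw`. -/
def IsLocal (Alg : BTree → ℕ → BTree → Prop) (wdw : ℕ) : Prop :=
  ∀ T s T', Alg T s T' → ∀ A, IsAfterTree T s T' A → HasLocalDecomp s (pathTree s T) A wdw

open scoped Classical in
noncomputable def stair (n : ℕ) (h : ℕ → ℕ) (s : ℕ) : Finset ℕ :=
  (Finset.Icc 1 n).filter
    (fun b => ∀ b' ∈ Finset.Icc 1 n, ((s < b' ∧ b' < b) ∨ (b < b' ∧ b' < s)) → h b' < h b)

open scoped Classical in
noncomputable def nbhd (n : ℕ) (h : ℕ → ℕ) (a : ℕ) : Finset ℕ :=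
  (Finset.Icc 1 n).filter
    (fun b => ∀ b' ∈ Finset.Icc 1 n, b' ≠ a → min a b ≤ b' → b' ≤ max a b → h b' < h a)

/-- Geometric sum-of-logs partial potential. -/
noncomputable def phiGeo (n : ℕ) (h : ℕ → ℕ) (w : ℕ → ℝ) (X : Finset ℕ) : ℝ :=
  ∑ a ∈ X, Real.logb 2 (wsum w (nbhd n h a))

/-- `l` is (the reversal of) a valid search path to `s`, without `s`, deepest element first. -/
def ValidRevPath (s : ℕ) (l : List ℕ) : Prop :=
  l.Nodup ∧ s ∉ l ∧
  l.Pairwise (fun a b => (a < s → b < s → b < a) ∧ (s < a → s < b → a < b))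

end Paper

namespace Paper.BTree

theorem subtreeKeys_self (l r : BTree) (x : ℕ) :
    subtreeKeys (node l x r) x = keys (node l x r) := by
  simp [subtreeKeys, subtree?]

theorem subtreeKeys_of_lt {l r : BTree} {x a : ℕ} (h : a < x) :
    subtreeKeys (node l x r) a = subtreeKeys l a := by
  simp [subtreeKeys, subtree?, h, h.ne]

theorem subtreeKeys_of_gt {l r : BTree} {x a : ℕ} (h : x < a) :
    subtreeKeys (node l x r) a = subtreeKeys r a := by
  simp [subtreeKeys, subtree?, h.not_gt, h.ne']

theorem subtreeKeys_subset_keys (t : BTree) (a : ℕ) : subtreeKeys t a ⊆ keys t := by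
  induction t with
  | nil => simp [subtreeKeys, subtree?]
  | node l x r ihl ihr =>
    intro y hy
    rcases lt_trichotomy a x with h | rfl | h
    · rw [subtreeKeys_of_lt h] at hy
      simp [keys, ihl hy]
    · rwa [subtreeKeys_self] at hy
    · rw [subtreeKeys_of_gt h] at hy
      simp [keys, ihr hy]

theorem pathSet_subset_keys (t : BTree) (s : ℕ) : pathSet t s ⊆ keys t := by
  induction t with
  | nil => simp [pathSet, pathList]
  | node l x r ihl ihr =>
    intro y hy
    have hl := @ihl y
    have hr := @ihr y
    simp only [pathSet, pathList, keys, List.mem_toFinset, Finset.mem_insert,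
      Finset.mem_union] at *
    split_ifs at hy <;> simp only [List.mem_cons, List.not_mem_nil] at hy <;> tauto

/-- If `a < b` and `b` is at most as right-deep as `a`, then the whole subtree of `a` lies
below `b`. -/
theorem lt_of_mem_subtreeKeys_of_rightDepth_le {t : BTree} (ht : isBST t) {a b y : ℕ}
    (hab : a < b) (hd : rightDepth b t ≤ rightDepth a t) (hy : y ∈ subtreeKeys t a) :
    y < b := by
  induction t with
  | nil => simp [subtreeKeys, subtree?] at hy
  | node l x r ihl ihr =>
    obtain ⟨hl, -, htl, htr⟩ := ht
    rcases lt_trichotomy a x with h | rfl | h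
    · rw [subtreeKeys_of_lt h] at hy
      rcases lt_or_ge b x with hb | hb
      · exact ihl htl (by simpa [rightDepth, h, h.ne, hb, hb.ne] using hd) hy
      · exact (hl y (subtreeKeys_subset_keys l a hy)).trans_le hb
    · simp [rightDepth, hab.ne', hab.not_gt] at hd
    · have hb := h.trans hab
      rw [subtreeKeys_of_gt h] at hy
      exact ihr htr (by simpa [rightDepth, h.not_gt, h.ne', hb.not_gt, hb.ne'] using hd) hy

/-- The subtree of a node `b` on the search path to `s` contains every key in `[s, b]`. -/
theorem mem_subtreeKeys_of_mem_pathSet {t : BTree} (ht : isBST t) {s b y : ℕ}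
    (hb : b ∈ pathSet t s) (hy : y ∈ keys t) (hsy : s ≤ y) (hyb : y ≤ b) :
    y ∈ subtreeKeys t b := by
  induction t with
  | nil => simp [keys] at hy
  | node l x r ihl ihr =>
    obtain ⟨hl, hr, htl, htr⟩ := ht
    by_cases hbx : b = x
    · subst hbx
      rwa [subtreeKeys_self]
    simp only [keys, Finset.mem_insert, Finset.mem_union] at hy
    rcases lt_trichotomy s x with h | rfl | h
    · have hb' : b ∈ pathSet l s := by simpa [pathSet, pathList, h, h.ne, hbx] using hb
      have hlt := hl b (pathSet_subset_keys l s hb')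
      rw [subtreeKeys_of_lt hlt]
      refine ihl htl hb' ?_
      rcases hy with hy | hy | hy
      · omega
      · exact hy
      · have := hr y hy
        omega
    · simp [pathSet, pathList, hbx] at hb
    · have hb' : b ∈ pathSet r s := by
        simpa [pathSet, pathList, h.not_gt, h.ne', hbx] using hb
      rw [subtreeKeys_of_gt (hr b (pathSet_subset_keys r s hb'))]
      refine ihr htr hb' ?_
      rcases hy with hy | hy | hy
      · omega
      · have := hl y hy
        omega
      · exact hy

theorem lt_of_mem_subtreeKeys_of_root_lt {t : BTree} (ht : isBST t) {s a y : ℕ}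
    (hroot : root? t = some s) (hsa : s < a) (hy : y ∈ subtreeKeys t a) : s < y := by
  cases t with
  | nil => simp [root?] at hroot
  | node l x r =>
    obtain rfl : x = s := by simpa [root?] using hroot
    rw [subtreeKeys_of_gt hsa] at hy
    exact ht.2.1 y (subtreeKeys_subset_keys r a hy)

end Paper.BTree

open Paper Paper.BTree
/-- **Lemma (characterization of monotone pairs).** If `s < a < b`, `a` is a proper
descendant of `b` on the search path, and `{a,b}` is monotone (equal right-depths in the
after-tree), then `T'(a) ⊆ T(b)`. -/
theorem monotone_pair_lemma (T : BTree) (s : ℕ) (T' : BTree) (hacc : IsAccess T s T')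
    (a b : ℕ) (ha : a ∈ pathSet T s) (hb : b ∈ pathSet T s)
    (hsa : s < a) (hab : a < b)
    (hdesc : b ∈ pathSet T a) (hne : a ≠ b)
    (hmono : rightDepth a T' = rightDepth b T') :
    subtreeKeys T' a ⊆ subtreeKeys T b := by
  intro y hy
  exact mem_subtreeKeys_of_mem_pathSet hacc.hT hb
    (hacc.hkeys ▸ subtreeKeys_subset_keys T' a hy)
    (lt_of_mem_subtreeKeys_of_root_lt hacc.hT' hacc.hroot hsa hy).le
    (lt_of_mem_subtreeKeys_of_rightDepth_le hacc.hT' hab hmono.ge hy).le
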